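/- arXiv:math/0105162 — 2 statements merged into one kernel-verified Lean document; each statement's English description precedes it below -/
import Mathlib

section
/- Suppose in addition that 𝔤 carries a nondegenerate invariant symmetric bilinear form B with induced isomorphism I : 𝔤* → 𝔤 (B(Iξ, y) = ξ(y)). If the smooth map R : 𝔥* → Hom(𝔤*, 𝔤) satisfies (1) R(q)(ad*_h ζ) = [R(q)ζ, h] for all q, h ∈ 𝔥, ζ ∈ 𝔤*, (2) χ(R(q)ζ) = −ζ(R(q)χ) for all q, ζ, χ, and (3) the modified dynamical Yang–Baxter equation: there is a constant c ∈ ℝ such that for all q ∈ 𝔥* and ζ, χ ∈ 𝔤*, [R(q)ζ, R(q)χ] − R(q)( I⁻¹[R(q)ζ, Iχ] + I⁻¹[Iζ, R(q)χ] ) + (D(R(·)χ))(q)(i*ζ) − (D(R(·)ζ))(q)(i*χ) + i(d_q(q' ↦ χ(R(q')ζ))) = c·[Iζ, Iχ], then the bracket and anchor defined below make the space of sections C∞(𝔥*, 𝔥 × 𝔤*) into a Lie algebroid over 𝔥*: the bracket is ℝ-bilinear, skew-symmetric, satisfies the Jacobi identity, satisfies a_*([F,G]) = [a_*(F), a_*(G)]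 as vector fields on 𝔥*, and satisfies the Leibniz rule [F, fG] = f·[F,G] + (df(a_*(F)))·G for smooth f : 𝔥* → ℝ. -/
noncomputable section

/-! **Statement 2.**  Same setting as Statement 1: `𝔤` is a finite-dimensional real Lie
algebra (bracket `brk` on a normed space), `𝔥 ⊆ 𝔤` an abelian subalgebra given by the
injective `i`, duals are continuous duals, `e : 𝔥 ≃ (𝔥*)*` canonical.  Now `𝔤` also
carries a nondegenerate invariant symmetric bilinear form `B` with induced isomorphism
`Iop : 𝔤* ≃ 𝔤` (`B (Iop ξ) y = ξ y`).  If `R` is 𝔥-equivariant, skew, and satisfies the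
modified dynamical Yang–Baxter equation for some constant `c`, then the bracket and
anchor below make the smooth sections `𝔥* → 𝔥 × 𝔤*` into a Lie algebroid. -/

variable {H G : Type*}
  [NormedAddCommGroup H] [NormedSpace ℝ H] [FiniteDimensional ℝ H]
  [NormedAddCommGroup G] [NormedSpace ℝ G] [FiniteDimensional ℝ G]

/-- The coadjoint action `ad*_X ξ = ξ ∘ ad_X`, for a Lie bracket `brk` on `G`. -/
def coadj (brk : G →ₗ[ℝ] G →ₗ[ℝ] G) (X : G) (ξ : G →L[ℝ] ℝ) : G →L[ℝ] ℝ :=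
  ξ.comp (LinearMap.toContinuousLinearMap (brk X))

/-- The restriction map `i* : 𝔤* → 𝔥*`. -/
def istar (i : H →ₗ[ℝ] G) (ξ : G →L[ℝ] ℝ) : H →L[ℝ] ℝ :=
  ξ.comp (LinearMap.toContinuousLinearMap i)

/-- The anchor `a_*(F)(q) = i*((F q).2)`, a vector field on `𝔥*`. -/
def anchor (i : H →ₗ[ℝ] G) (F : (H →L[ℝ] ℝ) → H × (G →L[ℝ] ℝ)) :
    (H →L[ℝ] ℝ) → (H →L[ℝ] ℝ) :=
  fun q => istar i ((F q).2)

/-- The Lie bracket of vector fields on `𝔥*`. -/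
def vfBracket (V W : (H →L[ℝ] ℝ) → (H →L[ℝ] ℝ)) : (H →L[ℝ] ℝ) → (H →L[ℝ] ℝ) :=
  fun q => fderiv ℝ W q (V q) - fderiv ℝ V q (W q)

/-- The bracket on sections `F = (ω, ξ), G' = (θ, η) : 𝔥* → 𝔥 × 𝔤*` determined by
`R : 𝔥* → Hom(𝔤*, 𝔤)`. -/
def secBracket (e : H ≃ₗ[ℝ] ((H →L[ℝ] ℝ) →L[ℝ] ℝ))
    (brk : G →ₗ[ℝ] G →ₗ[ℝ] G) (i : H →ₗ[ℝ] G)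
    (R : (H →L[ℝ] ℝ) → ((G →L[ℝ] ℝ) →L[ℝ] G))
    (F G' : (H →L[ℝ] ℝ) → H × (G →L[ℝ] ℝ)) :
    (H →L[ℝ] ℝ) → H × (G →L[ℝ] ℝ) :=
  fun q =>
    ( e.symm (fderiv ℝ (fun q' => (G' q).2 (R q' ((F q).2))) q)
        + fderiv ℝ (fun q' => (G' q').1) q (istar i ((F q).2))
        - fderiv ℝ (fun q' => (F q').1) q (istar i ((G' q).2)) ,
      coadj brk (i ((F q).1)) ((G' q).2) - coadj brk (i ((G' q).1)) ((F q).2)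
        - coadj brk (R q ((F q).2)) ((G' q).2) + coadj brk (R q ((G' q).2)) ((F q).2)
        + fderiv ℝ (fun q' => (G' q').2) q (istar i ((F q).2))
        - fderiv ℝ (fun q' => (F q').2) q (istar i ((G' q).2)) )

section Helpers

set_option maxSynthPendingDepth 3
set_option linter.unusedSectionVars false

/-- The gauge element `i ω - R ξ` of `𝔤` attached to a section `(ω, ξ)`; it acts on `𝔤*` through
the coadjoint action in the bracket of sections. -/
def gaugeElt (i : H →ₗ[ℝ] G) (R : (H →L[ℝ] ℝ) → ((G →L[ℝ] ℝ) →L[ℝ] G))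
    (F : (H →L[ℝ] ℝ) → H × (G →L[ℝ] ℝ)) (q : H →L[ℝ] ℝ) : G :=
  i (F q).1 - R q (F q).2

@[simp]
theorem coadj_apply (brk : G →ₗ[ℝ] G →ₗ[ℝ] G) (X : G) (ξ : G →L[ℝ] ℝ) (y : G) :
    coadj brk X ξ y = ξ (brk X y) := rfl

@[simp]
theorem istar_apply (i : H →ₗ[ℝ] G) (ξ : G →L[ℝ] ℝ) (x : H) : istar i ξ x = ξ (i x) := rfl

theorem istar_add (i : H →ₗ[ℝ] G) (ξ η : G →L[ℝ] ℝ) :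
    istar i (ξ + η) = istar i ξ + istar i η := rfl

theorem istar_smul (i : H →ₗ[ℝ] G) (c : ℝ) (ξ : G →L[ℝ] ℝ) :
    istar i (c • ξ) = c • istar i ξ := rfl

/-- The restriction map as a continuous linear map. -/
def istarCLM (i : H →ₗ[ℝ] G) : (G →L[ℝ] ℝ) →L[ℝ] (H →L[ℝ] ℝ) :=
  ContinuousLinearMap.precomp ℝ (LinearMap.toContinuousLinearMap i)

theorem istarCLM_apply (i : H →ₗ[ℝ] G) (ξ : G →L[ℝ] ℝ) : istarCLM i ξ = istar i ξ := rfl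

theorem pairing_symm {e : H ≃ₗ[ℝ] ((H →L[ℝ] ℝ) →L[ℝ] ℝ)}
    (he : ∀ (x : H) (ξ : H →L[ℝ] ℝ), e x ξ = ξ x)
    (φ : (H →L[ℝ] ℝ) →L[ℝ] ℝ) (v : H →L[ℝ] ℝ) : v (e.symm φ) = φ v := by
  rw [← he, e.apply_symm_apply]

theorem contDiff_of_forall_dual {e : H ≃ₗ[ℝ] ((H →L[ℝ] ℝ) →L[ℝ] ℝ)}
    (he : ∀ (x : H) (ξ : H →L[ℝ] ℝ), e x ξ = ξ x) {f : (H →L[ℝ] ℝ) → H}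
    (hf : ∀ v : H →L[ℝ] ℝ, ContDiff ℝ (⊤ : ℕ∞) fun q => v (f q)) :
    ContDiff ℝ (⊤ : ℕ∞) f := by
  have h : ContDiff ℝ (⊤ : ℕ∞) fun q => e (f q) :=
    contDiff_clm_apply_iff.2 fun v => by simpa only [he] using hf v
  have h' := (LinearMap.toContinuousLinearMap e.symm.toLinearMap).contDiff.comp h
  simpa [Function.comp_def] using h'

section Calculus

variable {R : (H →L[ℝ] ℝ) → ((G →L[ℝ] ℝ) →L[ℝ] G)} {F G' : (H →L[ℝ] ℝ) → H × (G →L[ℝ] ℝ)}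

theorem fderiv_pairing (hR : ContDiff ℝ (⊤ : ℕ∞) R) (ζ χ : G →L[ℝ] ℝ) (q v : H →L[ℝ] ℝ) :
    fderiv ℝ (fun q' => χ (R q' ζ)) q v = χ (fderiv ℝ R q v ζ) := by
  have hRq : HasFDerivAt R (fderiv ℝ R q) q := (hR.differentiable (by simp) q).hasFDerivAt
  have h := χ.hasFDerivAt.comp q (hRq.clm_apply (hasFDerivAt_const ζ q))
  simp only [Function.comp_def] at h
  rw [h.fderiv]
  simp

theorem fderiv_apply_const (hR : ContDiff ℝ (⊤ : ℕ∞) R) (ζ : G →L[ℝ] ℝ) (q v : H →L[ℝ] ℝ) :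
    fderiv ℝ (fun q' => R q' ζ) q v = fderiv ℝ R q v ζ := by
  have hRq : HasFDerivAt R (fderiv ℝ R q) q := (hR.differentiable (by simp) q).hasFDerivAt
  rw [(hRq.clm_apply (hasFDerivAt_const ζ q)).fderiv]
  simp

theorem fderiv_clm_comp_apply {E E₁ E₂ : Type*} [NormedAddCommGroup E] [NormedSpace ℝ E]
    [NormedAddCommGroup E₁] [NormedSpace ℝ E₁] [NormedAddCommGroup E₂] [NormedSpace ℝ E₂]
    (L : E₁ →L[ℝ] E₂) {f : E → E₁} (hf : ContDiff ℝ (⊤ : ℕ∞) f) (q u : E) :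
    fderiv ℝ (fun q' => L (f q')) q u = L (fderiv ℝ f q u) := by
  have h := L.hasFDerivAt.comp q (hf.differentiable (by simp) q).hasFDerivAt
  simp only [Function.comp_def] at h
  rw [h.fderiv]
  rfl

theorem contDiff_gaugeElt (i : H →ₗ[ℝ] G) (hR : ContDiff ℝ (⊤ : ℕ∞) R)
    (hF : ContDiff ℝ (⊤ : ℕ∞) F) : ContDiff ℝ (⊤ : ℕ∞) (gaugeElt i R F) :=
  ((LinearMap.toContinuousLinearMap i).contDiff.comp hF.fst).sub (hR.clm_apply hF.snd)

theorem fderiv_gaugeElt (i : H →ₗ[ℝ] G) (hR : ContDiff ℝ (⊤ : ℕ∞) R)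
    (hF : ContDiff ℝ (⊤ : ℕ∞) F) (q u : H →L[ℝ] ℝ) :
    fderiv ℝ (gaugeElt i R F) q u = i (fderiv ℝ (fun q' => (F q').1) q u)
      - fderiv ℝ R q u (F q).2 - R q (fderiv ℝ (fun q' => (F q').2) q u) := by
  have hRq : HasFDerivAt R (fderiv ℝ R q) q := (hR.differentiable (by simp) q).hasFDerivAt
  have h1 := (hF.fst.differentiable (by simp) q).hasFDerivAt
  have h2 := (hF.snd.differentiable (by simp) q).hasFDerivAt
  have h := ((LinearMap.toContinuousLinearMap i).hasFDerivAt.comp q h1).sub (hRq.clm_apply h2)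
  rw [show fderiv ℝ (gaugeElt i R F) q = _ from h.fderiv]
  simp
  abel

variable {e : H ≃ₗ[ℝ] ((H →L[ℝ] ℝ) →L[ℝ] ℝ)} (brk : G →ₗ[ℝ] G →ₗ[ℝ] G) (i : H →ₗ[ℝ] G)

theorem secBracket_snd_apply (q : H →L[ℝ] ℝ) (y : G) :
    (secBracket e brk i R F G' q).2 y =
      (G' q).2 (brk (gaugeElt i R F q) y) - (F q).2 (brk (gaugeElt i R G' q) y)
        + fderiv ℝ (fun q' => (G' q').2) q (istar i (F q).2) y
        - fderiv ℝ (fun q' => (F q').2) q (istar i (G' q).2) y := by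
  simp [secBracket, gaugeElt]
  ring

theorem pairing_secBracket_fst (he : ∀ (x : H) (ξ : H →L[ℝ] ℝ), e x ξ = ξ x)
    (hR : ContDiff ℝ (⊤ : ℕ∞) R) (q v : H →L[ℝ] ℝ) :
    v (secBracket e brk i R F G' q).1 =
      (G' q).2 (fderiv ℝ R q v (F q).2)
        + v (fderiv ℝ (fun q' => (G' q').1) q (istar i (F q).2))
        - v (fderiv ℝ (fun q' => (F q').1) q (istar i (G' q).2)) := by
  simp only [secBracket, map_add, map_sub, pairing_symm he, fderiv_pairing hR]

variable {E : Type*} [NormedAddCommGroup E] [NormedSpace ℝ E] {X : (H →L[ℝ] ℝ) → E}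

theorem contDiff_fderiv_istar (hX : ContDiff ℝ (⊤ : ℕ∞) X) (hF : ContDiff ℝ (⊤ : ℕ∞) F) :
    ContDiff ℝ (⊤ : ℕ∞) fun q => fderiv ℝ X q (istar i (F q).2) :=
  (hX.fderiv_right (by simp)).clm_apply ((istarCLM i).contDiff.comp hF.snd)

theorem fderiv_fderiv_istar (hX : ContDiff ℝ (⊤ : ℕ∞) X) (hF : ContDiff ℝ (⊤ : ℕ∞) F)
    (q u : H →L[ℝ] ℝ) :
    fderiv ℝ (fun q' => fderiv ℝ X q' (istar i (F q').2)) q u =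
      fderiv ℝ (fderiv ℝ X) q u (istar i (F q).2)
        + fderiv ℝ X q (istar i (fderiv ℝ (fun q' => (F q').2) q u)) := by
  have hX' : ContDiff ℝ (⊤ : ℕ∞) (fderiv ℝ X) := hX.fderiv_right (by simp)
  have h1 := (hX'.differentiable (by simp) q).hasFDerivAt
  have h2 := (istarCLM i).hasFDerivAt.comp q (hF.snd.differentiable (by simp) q).hasFDerivAt
  rw [show fderiv ℝ (fun q' => fderiv ℝ X q' (istar i (F q').2)) q = _ from
    (h1.clm_apply h2).fderiv]
  simp [istarCLM_apply, add_comm]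

theorem contDiff_dual_brk_gaugeElt (hR : ContDiff ℝ (⊤ : ℕ∞) R) (hF : ContDiff ℝ (⊤ : ℕ∞) F)
    (hG : ContDiff ℝ (⊤ : ℕ∞) G') (y : G) :
    ContDiff ℝ (⊤ : ℕ∞) fun q => (G' q).2 (brk (gaugeElt i R F q) y) :=
  hG.snd.clm_apply
    ((LinearMap.toContinuousLinearMap (brk.flip y)).contDiff.comp (contDiff_gaugeElt i hR hF))

theorem fderiv_dual_brk_gaugeElt (hR : ContDiff ℝ (⊤ : ℕ∞) R) (hF : ContDiff ℝ (⊤ : ℕ∞) F)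
    (hG : ContDiff ℝ (⊤ : ℕ∞) G') (q u : H →L[ℝ] ℝ) (y : G) :
    fderiv ℝ (fun q' => (G' q').2 (brk (gaugeElt i R F q') y)) q u =
      fderiv ℝ (fun q' => (G' q').2) q u (brk (gaugeElt i R F q) y)
        + (G' q).2 (brk (fderiv ℝ (gaugeElt i R F) q u) y) := by
  have h1 := (hG.snd.differentiable (by simp) q).hasFDerivAt
  have h2 := (LinearMap.toContinuousLinearMap (brk.flip y)).hasFDerivAt.comp q
    ((contDiff_gaugeElt i hR hF).differentiable (by simp) q).hasFDerivAt
  rw [show fderiv ℝ (fun q' => (G' q').2 (brk (gaugeElt i R F q') y)) q = _ from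
    (h1.clm_apply h2).fderiv]
  simp [add_comm]

theorem contDiff_secBracket_snd (hR : ContDiff ℝ (⊤ : ℕ∞) R) (hF : ContDiff ℝ (⊤ : ℕ∞) F)
    (hG : ContDiff ℝ (⊤ : ℕ∞) G') :
    ContDiff ℝ (⊤ : ℕ∞) fun q => (secBracket e brk i R F G' q).2 := by
  refine contDiff_clm_apply_iff.2 fun y => ?_
  simp only [secBracket_snd_apply]
  exact (((contDiff_dual_brk_gaugeElt brk i hR hF hG y).sub
    (contDiff_dual_brk_gaugeElt brk i hR hG hF y)).add
    ((contDiff_fderiv_istar i hG.snd hF).clm_apply contDiff_const)).sub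
    ((contDiff_fderiv_istar i hF.snd hG).clm_apply contDiff_const)

theorem contDiff_secBracket_fst (he : ∀ (x : H) (ξ : H →L[ℝ] ℝ), e x ξ = ξ x)
    (hR : ContDiff ℝ (⊤ : ℕ∞) R) (hF : ContDiff ℝ (⊤ : ℕ∞) F)
    (hG : ContDiff ℝ (⊤ : ℕ∞) G') :
    ContDiff ℝ (⊤ : ℕ∞) fun q => (secBracket e brk i R F G' q).1 := by
  refine contDiff_of_forall_dual he fun v => ?_
  simp only [pairing_secBracket_fst brk i he hR]
  have hR' : ContDiff ℝ (⊤ : ℕ∞) (fderiv ℝ R) := hR.fderiv_right (by simp)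
  exact ((hG.snd.clm_apply ((hR'.clm_apply contDiff_const).clm_apply hF.snd)).add
    (v.contDiff.comp (contDiff_fderiv_istar i hG.fst hF))).sub
    (v.contDiff.comp (contDiff_fderiv_istar i hF.fst hG))

theorem fderiv_secBracket_snd (hR : ContDiff ℝ (⊤ : ℕ∞) R) (hF : ContDiff ℝ (⊤ : ℕ∞) F)
    (hG : ContDiff ℝ (⊤ : ℕ∞) G') (q u : H →L[ℝ] ℝ) (y : G) :
    fderiv ℝ (fun q' => (secBracket e brk i R F G' q').2) q u y =
      fderiv ℝ (fun q' => (G' q').2) q u (brk (gaugeElt i R F q) y)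
        + (G' q).2 (brk (fderiv ℝ (gaugeElt i R F) q u) y)
        - (fderiv ℝ (fun q' => (F q').2) q u (brk (gaugeElt i R G' q) y)
          + (F q).2 (brk (fderiv ℝ (gaugeElt i R G') q u) y))
        + (fderiv ℝ (fderiv ℝ fun q' => (G' q').2) q u (istar i (F q).2) y
          + fderiv ℝ (fun q' => (G' q').2) q (istar i (fderiv ℝ (fun q' => (F q').2) q u)) y)
        - (fderiv ℝ (fderiv ℝ fun q' => (F q').2) q u (istar i (G' q).2) y
          + fderiv ℝ (fun q' => (F q').2) q (istar i (fderiv ℝ (fun q' => (G' q').2) q u)) y) := by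
  let ev : (G →L[ℝ] ℝ) →L[ℝ] ℝ := ContinuousLinearMap.apply ℝ ℝ y
  have hFG := contDiff_fderiv_istar i hG.snd hF
  have hGF := contDiff_fderiv_istar i hF.snd hG
  have c1 := contDiff_dual_brk_gaugeElt brk i hR hF hG y
  have c2 := contDiff_dual_brk_gaugeElt brk i hR hG hF y
  have c3 := ev.contDiff.comp hFG
  have c4 := ev.contDiff.comp hGF
  have d {f : (H →L[ℝ] ℝ) → ℝ} (hf : ContDiff ℝ (⊤ : ℕ∞) f) : HasFDerivAt f (fderiv ℝ f q) q :=
    (hf.differentiable (by simp) q).hasFDerivAt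
  have key := (((d c1).sub (d c2)).add (d c3)).sub (d c4)
  have hev := fderiv_clm_comp_apply ev (contDiff_secBracket_snd (e := e) brk i hR hF hG) q u
  change _ = fderiv ℝ (fun q' => (secBracket e brk i R F G' q').2) q u y at hev
  rw [← hev]
  have hfun : (fun q' => ev (secBracket e brk i R F G' q').2) = _ :=
    funext fun q' => secBracket_snd_apply (e := e) brk i q' y
  rw [hfun]
  refine (DFunLike.congr_fun key.fderiv u).trans ?_
  have e3 := fderiv_clm_comp_apply ev hFG q u
  have e4 := fderiv_clm_comp_apply ev hGF q u
  rw [fderiv_fderiv_istar i hG.snd hF] at e3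
  rw [fderiv_fderiv_istar i hF.snd hG] at e4
  simp only [sub_apply, add_apply]
  rw [fderiv_dual_brk_gaugeElt brk i hR hF hG, fderiv_dual_brk_gaugeElt brk i hR hG hF]
  exact congrArg₂ _ (congrArg₂ _ rfl e3) e4

theorem pairing_fderiv_secBracket_fst (he : ∀ (x : H) (ξ : H →L[ℝ] ℝ), e x ξ = ξ x)
    (hR : ContDiff ℝ (⊤ : ℕ∞) R) (hF : ContDiff ℝ (⊤ : ℕ∞) F)
    (hG : ContDiff ℝ (⊤ : ℕ∞) G') (q u v : H →L[ℝ] ℝ) :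
    v (fderiv ℝ (fun q' => (secBracket e brk i R F G' q').1) q u) =
      fderiv ℝ (fun q' => (G' q').2) q u (fderiv ℝ R q v (F q).2)
        + (G' q).2 (fderiv ℝ (fderiv ℝ R) q u v (F q).2)
        + (G' q).2 (fderiv ℝ R q v (fderiv ℝ (fun q' => (F q').2) q u))
        + v (fderiv ℝ (fderiv ℝ fun q' => (G' q').1) q u (istar i (F q).2)
          + fderiv ℝ (fun q' => (G' q').1) q (istar i (fderiv ℝ (fun q' => (F q').2) q u)))
        - v (fderiv ℝ (fderiv ℝ fun q' => (F q').1) q u (istar i (G' q).2)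
          + fderiv ℝ (fun q' => (F q').1) q (istar i (fderiv ℝ (fun q' => (G' q').2) q u))) := by
  have hR' : ContDiff ℝ (⊤ : ℕ∞) (fderiv ℝ R) := hR.fderiv_right (by simp)
  have hFG := contDiff_fderiv_istar i hG.fst hF
  have hGF := contDiff_fderiv_istar i hF.fst hG
  have h1 := (hG.snd.differentiable (by simp) q).hasFDerivAt.clm_apply
    (((hR'.differentiable (by simp) q).hasFDerivAt.clm_apply (hasFDerivAt_const v q)).clm_apply
      (hF.snd.differentiable (by simp) q).hasFDerivAt)
  have h3 := v.hasFDerivAt.comp q (hFG.differentiable (by simp) q).hasFDerivAt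
  have h4 := v.hasFDerivAt.comp q (hGF.differentiable (by simp) q).hasFDerivAt
  have key := (h1.add h3).sub h4
  rw [← fderiv_clm_comp_apply v (contDiff_secBracket_fst brk i he hR hF hG) q u]
  have hfun : (fun q' => v (secBracket e brk i R F G' q').1) = _ :=
    funext fun q' => pairing_secBracket_fst brk i he hR q' v
  rw [hfun]
  refine (DFunLike.congr_fun key.fderiv u).trans ?_
  simp [fderiv_fderiv_istar i hG.fst hF, fderiv_fderiv_istar i hF.fst hG]
  ring

theorem fderiv_fderiv_comm (hX : ContDiff ℝ (⊤ : ℕ∞) X) (q u v : H →L[ℝ] ℝ) :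
    fderiv ℝ (fderiv ℝ X) q u v = fderiv ℝ (fderiv ℝ X) q v u :=
  hX.contDiffAt.isSymmSndFDerivAt (by
    rw [minSmoothness_of_isRCLikeNormedField]
    exact WithTop.coe_le_coe.2 le_top) u v

end Calculus

theorem eq_of_forall_dual {e : H ≃ₗ[ℝ] ((H →L[ℝ] ℝ) →L[ℝ] ℝ)}
    (he : ∀ (x : H) (ξ : H →L[ℝ] ℝ), e x ξ = ξ x) {x y : H}
    (h : ∀ v : H →L[ℝ] ℝ, v x = v y) : x = y :=
  e.injective <| ContinuousLinearMap.ext fun v => by rw [he, he, h]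

theorem section_ext {e : H ≃ₗ[ℝ] ((H →L[ℝ] ℝ) →L[ℝ] ℝ)}
    (he : ∀ (x : H) (ξ : H →L[ℝ] ℝ), e x ξ = ξ x)
    {F G' : (H →L[ℝ] ℝ) → H × (G →L[ℝ] ℝ)}
    (h₁ : ∀ q v : H →L[ℝ] ℝ, v (F q).1 = v (G' q).1)
    (h₂ : ∀ (q : H →L[ℝ] ℝ) (y : G), (F q).2 y = (G' q).2 y) : F = G' :=
  funext fun q => Prod.ext (eq_of_forall_dual he (h₁ q)) (ContinuousLinearMap.ext (h₂ q))

theorem brk_skew {brk : G →ₗ[ℝ] G →ₗ[ℝ] G} (halt : ∀ x : G, brk x x = 0) (x y : G) :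
    brk x y = -brk y x := by
  have h := halt (x + y)
  simp only [map_add, LinearMap.add_apply, halt] at h
  simpa [add_comm, eq_neg_iff_add_eq_zero] using h

theorem Iop_symm_brk {brk : G →ₗ[ℝ] G →ₗ[ℝ] G} {B : G →ₗ[ℝ] G →ₗ[ℝ] ℝ}
    (hBinv : ∀ x y z : G, B (brk x y) z = B x (brk y z))
    (hBnondeg : ∀ x : G, (∀ y : G, B x y = 0) → x = 0)
    {Iop : (G →L[ℝ] ℝ) ≃ₗ[ℝ] G} (hIop : ∀ (ξ : G →L[ℝ] ℝ) (y : G), B (Iop ξ) y = ξ y)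
    (ζ : G →L[ℝ] ℝ) (X : G) : Iop.symm (brk (Iop ζ) X) = coadj brk X ζ := by
  rw [LinearEquiv.symm_apply_eq, ← sub_eq_zero]
  refine hBnondeg _ fun y => ?_
  simp [hBinv, hIop]

/-- The cyclic sum of `ad*_{[Iξ, Iη]} κ` vanishes. -/
theorem cyclic_coadj_brk_Iop {brk : G →ₗ[ℝ] G →ₗ[ℝ] G} (halt : ∀ x : G, brk x x = 0)
    (hjac : ∀ x y z : G, brk x (brk y z) = brk (brk x y) z + brk y (brk x z))
    {B : G →ₗ[ℝ] G →ₗ[ℝ] ℝ} (hBinv : ∀ x y z : G, B (brk x y) z = B x (brk y z))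
    {Iop : (G →L[ℝ] ℝ) ≃ₗ[ℝ] G} (hIop : ∀ (ξ : G →L[ℝ] ℝ) (y : G), B (Iop ξ) y = ξ y)
    (ξ η κ : G →L[ℝ] ℝ) (y : G) :
    κ (brk (brk (Iop ξ) (Iop η)) y) + ξ (brk (brk (Iop η) (Iop κ)) y)
      + η (brk (brk (Iop κ) (Iop ξ)) y) = 0 := by
  simp only [← hIop, ← hBinv]
  rw [← LinearMap.add_apply, ← map_add, ← LinearMap.add_apply, ← map_add,
    hjac (Iop κ), brk_skew halt (Iop η) (brk (Iop κ) _), brk_skew halt (Iop η) (Iop κ)]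
  simp

section Equivariant

variable {e : H ≃ₗ[ℝ] ((H →L[ℝ] ℝ) →L[ℝ] ℝ)} {brk : G →ₗ[ℝ] G →ₗ[ℝ] G} {i : H →ₗ[ℝ] G}
  {R : (H →L[ℝ] ℝ) → ((G →L[ℝ] ℝ) →L[ℝ] G)} {F G' K : (H →L[ℝ] ℝ) → H × (G →L[ℝ] ℝ)}

theorem fderiv_skew (hR : ContDiff ℝ (⊤ : ℕ∞) R)
    (hskew : ∀ (q : H →L[ℝ] ℝ) (ζ χ : G →L[ℝ] ℝ), χ (R q ζ) = - ζ (R q χ))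
    (q v : H →L[ℝ] ℝ) (ζ χ : G →L[ℝ] ℝ) :
    χ (fderiv ℝ R q v ζ) = - ζ (fderiv ℝ R q v χ) := by
  rw [← fderiv_pairing hR, ← fderiv_pairing hR, funext fun q' => hskew q' ζ χ, fderiv_fun_neg]
  rfl

theorem fderiv_fderiv_skew (hR : ContDiff ℝ (⊤ : ℕ∞) R)
    (hskew : ∀ (q : H →L[ℝ] ℝ) (ζ χ : G →L[ℝ] ℝ), χ (R q ζ) = - ζ (R q χ))
    (q u v : H →L[ℝ] ℝ) (ζ χ : G →L[ℝ] ℝ) :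
    χ (fderiv ℝ (fderiv ℝ R) q u v ζ) = - ζ (fderiv ℝ (fderiv ℝ R) q u v χ) := by
  have hR' : ContDiff ℝ (⊤ : ℕ∞) fun q' => fderiv ℝ R q' v :=
    (hR.fderiv_right (by simp)).clm_apply contDiff_const
  have h := fderiv_skew hR' (fun q' => fderiv_skew hR hskew q' v) q u ζ χ
  have hv : fderiv ℝ (fun q' => fderiv ℝ R q' v) q u = fderiv ℝ (fderiv ℝ R) q u v :=
    fderiv_clm_comp_apply (ContinuousLinearMap.apply ℝ ((G →L[ℝ] ℝ) →L[ℝ] G) v)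
      (hR.fderiv_right (by simp)) q u
  rwa [hv] at h

theorem fderiv_equivariant (hR : ContDiff ℝ (⊤ : ℕ∞) R)
    (hequiv : ∀ (q : H →L[ℝ] ℝ) (h : H) (ζ : G →L[ℝ] ℝ),
      R q (coadj brk (i h) ζ) = brk (R q ζ) (i h))
    (q v : H →L[ℝ] ℝ) (h : H) (ζ : G →L[ℝ] ℝ) :
    fderiv ℝ R q v (coadj brk (i h) ζ) = brk (fderiv ℝ R q v ζ) (i h) := by
  rw [← fderiv_apply_const hR, ← fderiv_apply_const hR, funext fun q' => hequiv q' h ζ]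
  exact fderiv_clm_comp_apply (LinearMap.toContinuousLinearMap (brk.flip (i h)))
    (hR.clm_apply contDiff_const) q v

/-- Skew-symmetric equivariant maps `T : 𝔤* → 𝔤` satisfy `κ [h, T η] = η [h, T κ]`. -/
theorem pairing_brk_comm (halt : ∀ x : G, brk x x = 0) {T : (G →L[ℝ] ℝ) →L[ℝ] G} {h : G}
    (hT : ∀ ζ, T (coadj brk h ζ) = brk (T ζ) h) (hskew : ∀ ζ χ : G →L[ℝ] ℝ, χ (T ζ) = - ζ (T χ))
    (η κ : G →L[ℝ] ℝ) : κ (brk h (T η)) = η (brk h (T κ)) := by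
  have h1 := hskew (coadj brk h η) κ
  rw [hT, brk_skew halt, map_neg, coadj_apply] at h1
  linarith

theorem istar_secBracket_snd (halt : ∀ x : G, brk x x = 0)
    (habelian : ∀ x y : H, brk (i x) (i y) = 0)
    (hequiv : ∀ (q : H →L[ℝ] ℝ) (h : H) (ζ : G →L[ℝ] ℝ),
      R q (coadj brk (i h) ζ) = brk (R q ζ) (i h))
    (hskew : ∀ (q : H →L[ℝ] ℝ) (ζ χ : G →L[ℝ] ℝ), χ (R q ζ) = - ζ (R q χ))
    (q : H →L[ℝ] ℝ) :
    istar i (secBracket e brk i R F G' q).2 =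
      istar i (fderiv ℝ (fun q' => (G' q').2) q (istar i (F q).2))
        - istar i (fderiv ℝ (fun q' => (F q').2) q (istar i (G' q).2)) := by
  ext h
  have h1 := pairing_brk_comm halt (hequiv q h) (hskew q) (F q).2 (G' q).2
  have h2 : ∀ X Y : H × (G →L[ℝ] ℝ),
      X.2 (brk (i Y.1 - R q Y.2) (i h)) = X.2 (brk (i h) (R q Y.2)) := by
    intro X Y
    rw [brk_skew halt (i h)]
    simp [habelian]
  simp only [istar_apply, secBracket_snd_apply, sub_apply, gaugeElt, h2]
  linarith

theorem secBracket_skew (he : ∀ (x : H) (ξ : H →L[ℝ] ℝ), e x ξ = ξ x)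
    (hR : ContDiff ℝ (⊤ : ℕ∞) R)
    (hskew : ∀ (q : H →L[ℝ] ℝ) (ζ χ : G →L[ℝ] ℝ), χ (R q ζ) = - ζ (R q χ)) :
    secBracket e brk i R F G' = - secBracket e brk i R G' F := by
  refine section_ext he (fun q v => ?_) fun q y => ?_
  · simp only [Pi.neg_apply, Prod.fst_neg, map_neg, pairing_secBracket_fst brk i he hR]
    rw [fderiv_skew hR hskew]
    ring
  · simp only [Pi.neg_apply, Prod.snd_neg, neg_apply, secBracket_snd_apply]
    ring

theorem secBracket_add_right (he : ∀ (x : H) (ξ : H →L[ℝ] ℝ), e x ξ = ξ x)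
    (hR : ContDiff ℝ (⊤ : ℕ∞) R) (hF : ContDiff ℝ (⊤ : ℕ∞) F) (hG : ContDiff ℝ (⊤ : ℕ∞) G') :
    secBracket e brk i R K (F + G') = secBracket e brk i R K F + secBracket e brk i R K G' := by
  have h1 (q : H →L[ℝ] ℝ) := fderiv_fun_add (hF.fst.differentiable (by simp) q)
    (hG.fst.differentiable (by simp) q)
  have h2 (q : H →L[ℝ] ℝ) := fderiv_fun_add (hF.snd.differentiable (by simp) q)
    (hG.snd.differentiable (by simp) q)
  refine section_ext he (fun q v => ?_) fun q y => ?_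
  · simp only [Pi.add_apply, Prod.fst_add, Prod.snd_add, map_add,
      pairing_secBracket_fst brk i he hR, h1, add_apply, istar_add]
    ring
  · simp only [Pi.add_apply, Prod.snd_add, Prod.fst_add, map_add, secBracket_snd_apply, h2,
      gaugeElt, add_apply, istar_add, map_sub, LinearMap.add_apply, LinearMap.sub_apply]
    ring

theorem secBracket_leibniz (he : ∀ (x : H) (ξ : H →L[ℝ] ℝ), e x ξ = ξ x)
    (hR : ContDiff ℝ (⊤ : ℕ∞) R) (hG : ContDiff ℝ (⊤ : ℕ∞) G')
    {f : (H →L[ℝ] ℝ) → ℝ} (hf : ContDiff ℝ (⊤ : ℕ∞) f) :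
    secBracket e brk i R F (fun q => f q • G' q) =
      fun q => f q • secBracket e brk i R F G' q + (fderiv ℝ f q (anchor i F q)) • G' q := by
  have h1 (q : H →L[ℝ] ℝ) := fderiv_fun_smul (hf.differentiable (by simp) q)
    (hG.fst.differentiable (by simp) q)
  have h2 (q : H →L[ℝ] ℝ) := fderiv_fun_smul (hf.differentiable (by simp) q)
    (hG.snd.differentiable (by simp) q)
  refine section_ext he (fun q v => ?_) fun q y => ?_
  · simp only [Prod.fst_add, Prod.smul_fst, Prod.smul_snd, map_add, map_smul, smul_apply,
      pairing_secBracket_fst brk i he hR, h1, add_apply, istar_smul, anchor, smul_eq_mul,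
      ContinuousLinearMap.smulRight_apply]
    ring
  · simp only [Prod.snd_add, Prod.smul_fst, Prod.smul_snd, map_smul, smul_apply,
      secBracket_snd_apply, h2, gaugeElt, add_apply, istar_smul, anchor, smul_eq_mul, map_sub,
      LinearMap.sub_apply, LinearMap.smul_apply, ContinuousLinearMap.smulRight_apply]
    ring

end Equivariant

section YangBaxter

variable {e : H ≃ₗ[ℝ] ((H →L[ℝ] ℝ) →L[ℝ] ℝ)} {brk : G →ₗ[ℝ] G →ₗ[ℝ] G} {i : H →ₗ[ℝ] G}
  {R : (H →L[ℝ] ℝ) → ((G →L[ℝ] ℝ) →L[ℝ] G)} {F G' K : (H →L[ℝ] ℝ) → H × (G →L[ℝ] ℝ)}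
  {N : (G →L[ℝ] ℝ) → (G →L[ℝ] ℝ) → G}

/-- The dynamical Yang–Baxter equation with right-hand side `N ζ χ`, with the bracket on `𝔤*`
written through the coadjoint action. -/
def DynamicalYangBaxter (e : H ≃ₗ[ℝ] ((H →L[ℝ] ℝ) →L[ℝ] ℝ)) (brk : G →ₗ[ℝ] G →ₗ[ℝ] G)
    (i : H →ₗ[ℝ] G) (R : (H →L[ℝ] ℝ) → ((G →L[ℝ] ℝ) →L[ℝ] G))
    (N : (G →L[ℝ] ℝ) → (G →L[ℝ] ℝ) → G) : Prop :=
  ∀ (q : H →L[ℝ] ℝ) (ζ χ : G →L[ℝ] ℝ),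
    brk (R q ζ) (R q χ) - R q (coadj brk (R q χ) ζ - coadj brk (R q ζ) χ)
      + fderiv ℝ R q (istar i ζ) χ - fderiv ℝ R q (istar i χ) ζ
      + i (e.symm (fderiv ℝ (fun q' => χ (R q' ζ)) q)) = N ζ χ

theorem gaugeElt_secBracket (halt : ∀ x : G, brk x x = 0)
    (habelian : ∀ x y : H, brk (i x) (i y) = 0)
    (hR : ContDiff ℝ (⊤ : ℕ∞) R) (hF : ContDiff ℝ (⊤ : ℕ∞) F) (hG : ContDiff ℝ (⊤ : ℕ∞) G')
    (hequiv : ∀ (q : H →L[ℝ] ℝ) (h : H) (ζ : G →L[ℝ] ℝ),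
      R q (coadj brk (i h) ζ) = brk (R q ζ) (i h))
    (hYB : DynamicalYangBaxter e brk i R N) (q : H →L[ℝ] ℝ) :
    gaugeElt i R (secBracket e brk i R F G') q =
      brk (gaugeElt i R G' q) (gaugeElt i R F q)
        + fderiv ℝ (gaugeElt i R G') q (istar i (F q).2)
        - fderiv ℝ (gaugeElt i R F) q (istar i (G' q).2) + N (F q).2 (G' q).2 := by
  rw [← hYB q, fderiv_gaugeElt i hR hF, fderiv_gaugeElt i hR hG]
  simp only [gaugeElt, secBracket, map_add, map_sub, LinearMap.sub_apply, habelian, hequiv]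
  rw [brk_skew halt (R q (G' q).2) (R q (F q).2), brk_skew halt (i (G' q).1) (R q (F q).2)]
  abel

/-- The Yang–Baxter equation, paired with `κ` and made cyclic by skew-symmetry. -/
theorem DynamicalYangBaxter.pairing (he : ∀ (x : H) (ξ : H →L[ℝ] ℝ), e x ξ = ξ x)
    (hR : ContDiff ℝ (⊤ : ℕ∞) R)
    (hskew : ∀ (q : H →L[ℝ] ℝ) (ζ χ : G →L[ℝ] ℝ), χ (R q ζ) = - ζ (R q χ))
    (hYB : DynamicalYangBaxter e brk i R N) (q : H →L[ℝ] ℝ) (ζ χ κ : G →L[ℝ] ℝ) :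
    κ (brk (R q ζ) (R q χ)) + ζ (brk (R q χ) (R q κ)) - χ (brk (R q ζ) (R q κ))
      + κ (fderiv ℝ R q (istar i ζ) χ) - κ (fderiv ℝ R q (istar i χ) ζ)
      + χ (fderiv ℝ R q (istar i κ) ζ) = κ (N ζ χ) := by
  have h1 : κ (i (e.symm (fderiv ℝ (fun q' => χ (R q' ζ)) q))) =
      χ (fderiv ℝ R q (istar i κ) ζ) := by
    rw [← istar_apply, pairing_symm he, fderiv_pairing hR]
  rw [← hYB q]
  simp only [map_add, map_sub, h1, hskew q _ κ, coadj_apply]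
  ring

theorem hasFDerivAt_pairing_brk (hR : ContDiff ℝ (⊤ : ℕ∞) R) (ζ χ κ : G →L[ℝ] ℝ)
    (q v : H →L[ℝ] ℝ) :
    HasFDerivAt (fun q' => κ (brk (R q' ζ) (R q' χ)))
      (fderiv ℝ (fun q' => κ (brk (R q' ζ) (R q' χ))) q) q ∧
    fderiv ℝ (fun q' => κ (brk (R q' ζ) (R q' χ))) q v =
      κ (brk (fderiv ℝ R q v ζ) (R q χ)) + κ (brk (R q ζ) (fderiv ℝ R q v χ)) := by
  let b : G →L[ℝ] G →L[ℝ] G := LinearMap.toContinuousLinearMap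
    ((LinearMap.toContinuousLinearMap : (G →ₗ[ℝ] G) ≃ₗ[ℝ] (G →L[ℝ] G)).toLinearMap ∘ₗ brk)
  have hRq : HasFDerivAt R (fderiv ℝ R q) q := (hR.differentiable (by simp) q).hasFDerivAt
  have h (α : G →L[ℝ] ℝ) := hRq.clm_apply (hasFDerivAt_const α q)
  have key : HasFDerivAt (fun q' => κ (brk (R q' ζ) (R q' χ))) _ q :=
    κ.hasFDerivAt.comp q ((b.hasFDerivAt.comp q (h ζ)).clm_apply (h χ))
  refine ⟨key.differentiableAt.hasFDerivAt, ?_⟩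
  rw [key.fderiv]
  simp [b, add_comm]

theorem hasFDerivAt_pairing_fderiv (hR : ContDiff ℝ (⊤ : ℕ∞) R) (ζ κ : G →L[ℝ] ℝ)
    (q u v : H →L[ℝ] ℝ) :
    HasFDerivAt (fun q' => κ (fderiv ℝ R q' u ζ))
      (fderiv ℝ (fun q' => κ (fderiv ℝ R q' u ζ)) q) q ∧
    fderiv ℝ (fun q' => κ (fderiv ℝ R q' u ζ)) q v = κ (fderiv ℝ (fderiv ℝ R) q v u ζ) := by
  have hR' : ContDiff ℝ (⊤ : ℕ∞) (fderiv ℝ R) := hR.fderiv_right (by simp)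
  have key : HasFDerivAt (fun q' => κ (fderiv ℝ R q' u ζ)) _ q :=
    κ.hasFDerivAt.comp q ((((hR'.differentiable (by simp) q).hasFDerivAt.clm_apply
      (hasFDerivAt_const u q)).clm_apply (hasFDerivAt_const ζ q)))
  refine ⟨key.differentiableAt.hasFDerivAt, ?_⟩
  rw [key.fderiv]
  simp

/-- The derivative of the Yang–Baxter equation: its right-hand side is constant. -/
theorem DynamicalYangBaxter.fderiv_pairing (he : ∀ (x : H) (ξ : H →L[ℝ] ℝ), e x ξ = ξ x)
    (hR : ContDiff ℝ (⊤ : ℕ∞) R)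
    (hskew : ∀ (q : H →L[ℝ] ℝ) (ζ χ : G →L[ℝ] ℝ), χ (R q ζ) = - ζ (R q χ))
    (hYB : DynamicalYangBaxter e brk i R N) (q v : H →L[ℝ] ℝ) (ζ χ κ : G →L[ℝ] ℝ) :
    (κ (brk (fderiv ℝ R q v ζ) (R q χ)) + κ (brk (R q ζ) (fderiv ℝ R q v χ)))
      + (ζ (brk (fderiv ℝ R q v χ) (R q κ)) + ζ (brk (R q χ) (fderiv ℝ R q v κ)))
      - (χ (brk (fderiv ℝ R q v ζ) (R q κ)) + χ (brk (R q ζ) (fderiv ℝ R q v κ)))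
      + κ (fderiv ℝ (fderiv ℝ R) q v (istar i ζ) χ)
      - κ (fderiv ℝ (fderiv ℝ R) q v (istar i χ) ζ)
      + χ (fderiv ℝ (fderiv ℝ R) q v (istar i κ) ζ) = 0 := by
  have a (ζ χ κ : G →L[ℝ] ℝ) := hasFDerivAt_pairing_brk (brk := brk) hR ζ χ κ q v
  have b (u : H →L[ℝ] ℝ) (ζ κ : G →L[ℝ] ℝ) := hasFDerivAt_pairing_fderiv hR ζ κ q u v
  have key := ((((((a ζ χ κ).1.add (a χ κ ζ).1).sub (a ζ κ χ).1).add
    (b (istar i ζ) χ κ).1).sub (b (istar i χ) ζ κ).1).add (b (istar i κ) ζ χ).1)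
  have hc : HasFDerivAt (fun _ : H →L[ℝ] ℝ => κ (N ζ χ)) _ q := key.congr_of_eventuallyEq
    (Filter.Eventually.of_forall fun q' => (hYB.pairing he hR hskew q' ζ χ κ).symm)
  have h0 := DFunLike.congr_fun (hc.unique (hasFDerivAt_const _ q)) v
  simpa only [add_apply, sub_apply, (a _ _ _).2, (b _ _ _).2, zero_apply] using h0

theorem jacobi_secBracket_fst (he : ∀ (x : H) (ξ : H →L[ℝ] ℝ), e x ξ = ξ x)
    (halt : ∀ x : G, brk x x = 0) (habelian : ∀ x y : H, brk (i x) (i y) = 0)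
    (hR : ContDiff ℝ (⊤ : ℕ∞) R) (hF : ContDiff ℝ (⊤ : ℕ∞) F)
    (hG : ContDiff ℝ (⊤ : ℕ∞) G') (hK : ContDiff ℝ (⊤ : ℕ∞) K)
    (hequiv : ∀ (q : H →L[ℝ] ℝ) (h : H) (ζ : G →L[ℝ] ℝ),
      R q (coadj brk (i h) ζ) = brk (R q ζ) (i h))
    (hskew : ∀ (q : H →L[ℝ] ℝ) (ζ χ : G →L[ℝ] ℝ), χ (R q ζ) = - ζ (R q χ))
    (hYB : DynamicalYangBaxter e brk i R N) (q v : H →L[ℝ] ℝ) :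
    v (secBracket e brk i R (secBracket e brk i R F G') K q).1
      + v (secBracket e brk i R (secBracket e brk i R G' K) F q).1
      + v (secBracket e brk i R (secBracket e brk i R K F) G' q).1 = 0 := by
  have hYB' := hYB.fderiv_pairing he hR hskew q v (F q).2 (G' q).2 (K q).2
  have hs (ζ χ : G →L[ℝ] ℝ) := fderiv_skew hR hskew q v ζ χ
  have hcomm (h : H) (η κ : G →L[ℝ] ℝ) :=
    pairing_brk_comm halt (fderiv_equivariant hR hequiv q v h) hs η κ
  have hsw (ψ α β : G →L[ℝ] ℝ) : ψ (brk (fderiv ℝ R q v α) (R q β)) =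
      -ψ (brk (R q β) (fderiv ℝ R q v α)) := by rw [brk_skew halt, map_neg]
  have hRR := fderiv_fderiv_comm hR q
  have hss := fderiv_fderiv_skew hR hskew q v (istar i (G' q).2) (F q).2 (K q).2
  simp only [pairing_secBracket_fst brk i he hR,
    istar_secBracket_snd halt habelian hequiv hskew,
    pairing_fderiv_secBracket_fst brk i he hR hF hG,
    pairing_fderiv_secBracket_fst brk i he hR hG hK,
    pairing_fderiv_secBracket_fst brk i he hR hK hF,
    hs (secBracket e brk i R _ _ q).2, secBracket_snd_apply, gaugeElt, map_add, map_sub,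
    LinearMap.sub_apply, hsw, hRR _ v] at hYB' ⊢
  rw [hcomm (F q).1 (G' q).2 (K q).2, hcomm (G' q).1 (K q).2 (F q).2,
    hcomm (K q).1 (F q).2 (G' q).2,
    fderiv_fderiv_comm hF.fst q (istar i (K q).2) (istar i (G' q).2),
    fderiv_fderiv_comm hG.fst q (istar i (F q).2) (istar i (K q).2),
    fderiv_fderiv_comm hK.fst q (istar i (G' q).2) (istar i (F q).2)]
  simp only [hs (F q).2, hs (G' q).2, hs (K q).2]
  linarith

theorem jacobi_secBracket_snd (halt : ∀ x : G, brk x x = 0)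
    (hjac : ∀ x y z : G, brk x (brk y z) = brk (brk x y) z + brk y (brk x z))
    (habelian : ∀ x y : H, brk (i x) (i y) = 0)
    (hR : ContDiff ℝ (⊤ : ℕ∞) R) (hF : ContDiff ℝ (⊤ : ℕ∞) F)
    (hG : ContDiff ℝ (⊤ : ℕ∞) G') (hK : ContDiff ℝ (⊤ : ℕ∞) K)
    (hequiv : ∀ (q : H →L[ℝ] ℝ) (h : H) (ζ : G →L[ℝ] ℝ),
      R q (coadj brk (i h) ζ) = brk (R q ζ) (i h))
    (hskew : ∀ (q : H →L[ℝ] ℝ) (ζ χ : G →L[ℝ] ℝ), χ (R q ζ) = - ζ (R q χ))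
    (hYB : DynamicalYangBaxter e brk i R N)
    (hN : ∀ (ξ η κ : G →L[ℝ] ℝ) (y : G),
      κ (brk (N ξ η) y) + ξ (brk (N η κ) y) + η (brk (N κ ξ) y) = 0)
    (q : H →L[ℝ] ℝ) (y : G) :
    (secBracket e brk i R (secBracket e brk i R F G') K q).2 y
      + (secBracket e brk i R (secBracket e brk i R G' K) F q).2 y
      + (secBracket e brk i R (secBracket e brk i R K F) G' q).2 y = 0 := by
  have hN' := hN (F q).2 (G' q).2 (K q).2 y
  have hjac' (x y z : G) : brk (brk x y) z = brk x (brk y z) - brk y (brk x z) := by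
    rw [hjac x, add_sub_cancel_right]
  simp only [secBracket_snd_apply, istar_secBracket_snd halt habelian hequiv hskew,
    gaugeElt_secBracket halt habelian hR hF hG hequiv hYB,
    gaugeElt_secBracket halt habelian hR hG hK hequiv hYB,
    gaugeElt_secBracket halt habelian hR hK hF hequiv hYB,
    fderiv_secBracket_snd brk i hR hF hG, fderiv_secBracket_snd brk i hR hG hK,
    fderiv_secBracket_snd brk i hR hK hF, map_add, map_sub, LinearMap.add_apply,
    LinearMap.sub_apply, sub_apply, hjac']
  rw [fderiv_fderiv_comm hF.snd q (istar i (K q).2) (istar i (G' q).2),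
    fderiv_fderiv_comm hG.snd q (istar i (F q).2) (istar i (K q).2),
    fderiv_fderiv_comm hK.snd q (istar i (G' q).2) (istar i (F q).2)]
  linarith

end YangBaxter

end Helpers

theorem mDYBE_gives_lie_algebroid
    (e : H ≃ₗ[ℝ] ((H →L[ℝ] ℝ) →L[ℝ] ℝ))
    (he : ∀ (x : H) (ξ : H →L[ℝ] ℝ), e x ξ = ξ x)
    (brk : G →ₗ[ℝ] G →ₗ[ℝ] G)
    (halt : ∀ x : G, brk x x = 0)
    (hjac : ∀ x y z : G, brk x (brk y z) = brk (brk x y) z + brk y (brk x z))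
    (i : H →ₗ[ℝ] G) (hi : Function.Injective i)
    (habelian : ∀ x y : H, brk (i x) (i y) = 0)
    (B : G →ₗ[ℝ] G →ₗ[ℝ] ℝ)
    (hBsymm : ∀ x y : G, B x y = B y x)
    (hBinv : ∀ x y z : G, B (brk x y) z = B x (brk y z))
    (hBnondeg : ∀ x : G, (∀ y : G, B x y = 0) → x = 0)
    (Iop : (G →L[ℝ] ℝ) ≃ₗ[ℝ] G)
    (hIop : ∀ (ξ : G →L[ℝ] ℝ) (y : G), B (Iop ξ) y = ξ y)
    (R : (H →L[ℝ] ℝ) → ((G →L[ℝ] ℝ) →L[ℝ] G))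
    (hR : ContDiff ℝ (⊤ : ℕ∞) R)
    -- (1) 𝔥-equivariance:
    (hequiv : ∀ (q : H →L[ℝ] ℝ) (h : H) (ζ : G →L[ℝ] ℝ),
      R q (coadj brk (i h) ζ) = brk (R q ζ) (i h))
    -- (2) skewness `R(q)* = -R(q)`:
    (hskew : ∀ (q : H →L[ℝ] ℝ) (ζ χ : G →L[ℝ] ℝ), χ (R q ζ) = - ζ (R q χ))
    -- (3) the modified dynamical Yang–Baxter equation:
    (hmDYBE : ∃ c : ℝ, ∀ (q : H →L[ℝ] ℝ) (ζ χ : G →L[ℝ] ℝ),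
      brk (R q ζ) (R q χ)
          - R q (Iop.symm (brk (R q ζ) (Iop χ)) + Iop.symm (brk (Iop ζ) (R q χ)))
          + fderiv ℝ (fun q' => R q' χ) q (istar i ζ)
          - fderiv ℝ (fun q' => R q' ζ) q (istar i χ)
          + i (e.symm (fderiv ℝ (fun q' => χ (R q' ζ)) q))
        = c • brk (Iop ζ) (Iop χ)) :
    -- conclusion: the smooth sections form a Lie algebroid
    ( (∀ F F' G' : (H →L[ℝ] ℝ) → H × (G →L[ℝ] ℝ),
        ContDiff ℝ (⊤ : ℕ∞) F → ContDiff ℝ (⊤ : ℕ∞) F' → ContDiff ℝ (⊤ : ℕ∞) G' →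
          secBracket e brk i R (F + F') G'
            = secBracket e brk i R F G' + secBracket e brk i R F' G' ∧
          secBracket e brk i R G' (F + F')
            = secBracket e brk i R G' F + secBracket e brk i R G' F') ∧
      (∀ (c : ℝ) (F G' : (H →L[ℝ] ℝ) → H × (G →L[ℝ] ℝ)),
        ContDiff ℝ (⊤ : ℕ∞) F → ContDiff ℝ (⊤ : ℕ∞) G' →
          secBracket e brk i R (c • F) G' = c • secBracket e brk i R F G' ∧
          secBracket e brk i R F (c • G') = c • secBracket e brk i R F G') ∧
      (∀ F G' : (H →L[ℝ] ℝ) → H × (G →L[ℝ] ℝ),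
        ContDiff ℝ (⊤ : ℕ∞) F → ContDiff ℝ (⊤ : ℕ∞) G' →
          secBracket e brk i R F G' = - secBracket e brk i R G' F) ∧
      (∀ F G' K : (H →L[ℝ] ℝ) → H × (G →L[ℝ] ℝ),
        ContDiff ℝ (⊤ : ℕ∞) F → ContDiff ℝ (⊤ : ℕ∞) G' → ContDiff ℝ (⊤ : ℕ∞) K →
          secBracket e brk i R (secBracket e brk i R F G') K
            + secBracket e brk i R (secBracket e brk i R G' K) F
            + secBracket e brk i R (secBracket e brk i R K F) G' = 0) ∧
      (∀ F G' : (H →L[ℝ] ℝ) → H × (G →L[ℝ] ℝ),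
        ContDiff ℝ (⊤ : ℕ∞) F → ContDiff ℝ (⊤ : ℕ∞) G' →
          anchor i (secBracket e brk i R F G')
            = vfBracket (anchor i F) (anchor i G')) ∧
      (∀ F G' : (H →L[ℝ] ℝ) → H × (G →L[ℝ] ℝ), ∀ f : (H →L[ℝ] ℝ) → ℝ,
        ContDiff ℝ (⊤ : ℕ∞) F → ContDiff ℝ (⊤ : ℕ∞) G' → ContDiff ℝ (⊤ : ℕ∞) f →
          secBracket e brk i R F (fun q => f q • G' q)
            = fun q => f q • secBracket e brk i R F G' q
                + (fderiv ℝ f q (anchor i F q)) • G' q) ) := by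
  obtain ⟨c, hc⟩ := hmDYBE
  have hYB : DynamicalYangBaxter e brk i R fun ζ χ => c • brk (Iop ζ) (Iop χ) := by
    intro q ζ χ
    refine Eq.trans ?_ (hc q ζ χ)
    rw [fderiv_apply_const hR, fderiv_apply_const hR, brk_skew halt (R q ζ) (Iop χ),
      map_neg, Iop_symm_brk hBinv hBnondeg hIop, Iop_symm_brk hBinv hBnondeg hIop,
      neg_add_eq_sub]
  have hN (ξ η κ : G →L[ℝ] ℝ) (y : G) : κ (brk (c • brk (Iop ξ) (Iop η)) y)
      + ξ (brk (c • brk (Iop η) (Iop κ)) y) + η (brk (c • brk (Iop κ) (Iop ξ)) y) = 0 := by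
    have h := cyclic_coadj_brk_Iop halt hjac hBinv hIop ξ η κ y
    simp only [map_smul, LinearMap.smul_apply, smul_eq_mul, ← mul_add, h, mul_zero]
  have hsk (F G' : (H →L[ℝ] ℝ) → H × (G →L[ℝ] ℝ)) :
      secBracket e brk i R F G' = - secBracket e brk i R G' F := secBracket_skew he hR hskew
  have hsmul (c : ℝ) (F : (H →L[ℝ] ℝ) → H × (G →L[ℝ] ℝ)) {G' : (H →L[ℝ] ℝ) → H × (G →L[ℝ] ℝ)}
      (hG : ContDiff ℝ (⊤ : ℕ∞) G') :
      secBracket e brk i R F (c • G') = c • secBracket e brk i R F G' := by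
    refine (secBracket_leibniz he hR hG (contDiff_const (c := c))).trans (funext fun q => ?_)
    simp
  refine ⟨fun F F' G' hF hF' hG => ⟨?_, secBracket_add_right he hR hF hF'⟩,
    fun c F G' hF hG => ⟨?_, hsmul c F hG⟩, fun F G' _ _ => hsk F G',
    fun F G' K hF hG hK => section_ext he (fun q v => ?_) fun q y => ?_,
    fun F G' hF hG => funext fun q => ?_,
    fun F G' f _ hG hf => secBracket_leibniz he hR hG hf⟩
  · rw [hsk, secBracket_add_right he hR hF hF', hsk F, hsk F', neg_add]
  · rw [hsk, hsmul c G' hF, hsk F, smul_neg]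
  · simpa using jacobi_secBracket_fst he halt habelian hR hF hG hK hequiv hskew hYB q v
  · simpa using
      jacobi_secBracket_snd halt hjac habelian hR hF hG hK hequiv hskew hYB hN q y
  · simp only [anchor, vfBracket, istar_secBracket_snd halt habelian hequiv hskew]
    exact congrArg₂ _ (fderiv_clm_comp_apply (istarCLM i) hG.snd q _).symm
      (fderiv_clm_comp_apply (istarCLM i) hF.snd q _).symm

end
end

section
/- Let Δ' ⊆ Δ be a set of roots closed with respect to addition (if α, β ∈ Δ' and α+β ∈ Δ then α+β ∈ Δ') and with Δ' = −Δ', and let U := {q ∈ 𝔥* : (α,q) ≠ 0 for all α ∈ Δ'}. Define the rational dynamical r-matrix r(q,z) := z⁻¹·Ω + Σ_{α∈Δ'} ((α,q))⁻¹ · e_α ⊗ e_{−α} ∈ 𝔤 ⊗ 𝔤 for q ∈ U and z ∈ ℂ, z ≠ 0, where Ω ∈ 𝔤 ⊗ 𝔤 is the Casimir element of B (the unique element with (ξ ⊗ id)(Ω) = Iξ for all ξ ∈ 𝔤*, I the isomorphism 𝔤* → 𝔤 induced by B). Then for every q ∈ U, every v ∈ 𝔥*, and every z ≠ 0: the directional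 derivative of r in the first variable, (∂_q r)(q,z)(v), vanishes if and only if (α, v) = 0 for every α ∈ Δ'. -/
open scoped TensorProduct

/-- The derivative at `t = 0` of a linear functional applied to the rational r-matrix along the
line `q + t • v`. -/
theorem hasDerivAt_apply_sum_inv_smul {Q M : Type*} [AddCommGroup Q] [Module ℂ Q]
    [AddCommGroup M] [Module ℂ M] (s : Finset (Module.Dual ℂ Q)) (m : Module.Dual ℂ Q → M)
    (c : M) (q v : Q) (hq : ∀ α ∈ s, α q ≠ 0) (φ : Module.Dual ℂ M) :
    HasDerivAt (fun t : ℂ => φ (c + ∑ α ∈ s, (α (q + t • v))⁻¹ • m α))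
      (φ (∑ α ∈ s, (-(α v) / (α q) ^ 2) • m α)) 0 := by
  simp only [map_add, map_sum, map_smul, smul_eq_mul]
  refine (HasDerivAt.fun_sum fun α hα => ?_).const_add _
  have hlin : HasDerivAt (fun t : ℂ => α q + t * α v) (α v) 0 := by
    simpa using ((hasDerivAt_id (0 : ℂ)).mul_const (α v)).const_add (α q)
  simpa using (hlin.fun_inv (by simpa using hq α hα)).mul_const (φ (m α))

/-- Let `Δ' ⊆ Δ` be a set of roots closed under addition and with
`Δ' = -Δ'`, and let `r(q,z) = z⁻¹ • Ω + Σ_{α∈Δ'} (α,q)⁻¹ • e_α ⊗ e_{−α}` be the rational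
dynamical r-matrix (with `Ω` the Casimir element of the Killing form `B`).  Then for
every `q` with `(α,q) ≠ 0` on `Δ'`, every direction `v` and every `z ≠ 0`, the
directional derivative `D = (∂_q r)(q,z)(v)` (characterized componentwise against all
linear functionals `φ` on `𝔤 ⊗ 𝔤`) vanishes if and only if `(α, v) = 0` for all
`α ∈ Δ'`.  Roots are modelled as linear functionals on a complex vector space `Q`, with
`(α, q) = α q`. -/
theorem rational_r_matrix_q_derivative_vanishes_iff
    (g Q : Type*) [LieRing g] [LieAlgebra ℂ g]
    [AddCommGroup Q] [Module ℂ Q]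
    [DecidableEq (Module.Dual ℂ Q)]
    (B : g →ₗ[ℂ] g →ₗ[ℂ] ℂ)
    (hBsymm : ∀ x y : g, B x y = B y x)
    (hBinv : ∀ x y z : g, B ⁅x, y⁆ z = B x ⁅y, z⁆)
    (hBnondeg : ∀ x : g, (∀ y : g, B x y = 0) → x = 0)
    (Iop : Module.Dual ℂ g →ₗ[ℂ] g)
    (hIop : ∀ (ξ : Module.Dual ℂ g) (y : g), B (Iop ξ) y = ξ y)
    (Ω : TensorProduct ℂ g g)
    (hΩ : ∀ ξ : Module.Dual ℂ g,
      TensorProduct.lid ℂ g (TensorProduct.map ξ LinearMap.id Ω) = Iop ξ)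
    (Δ Δ' : Finset (Module.Dual ℂ Q))
    (hΔ'Δ : Δ' ⊆ Δ)
    (hadd : ∀ α ∈ Δ', ∀ β ∈ Δ', α + β ∈ Δ → α + β ∈ Δ')
    (hΔ'neg : ∀ α ∈ Δ', -α ∈ Δ')
    (e : Module.Dual ℂ Q → g)
    (hee : ∀ α ∈ Δ', ∀ β ∈ Δ', B (e α) (e β) = if β = -α then (1 : ℂ) else 0)
    (q : Q) (hq : ∀ α ∈ Δ', α q ≠ 0)
    (v : Q) (z : ℂ) (hz : z ≠ 0)
    (D : TensorProduct ℂ g g)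
    (hD : ∀ φ : Module.Dual ℂ (TensorProduct ℂ g g),
      HasDerivAt
        (fun t : ℂ =>
          φ (z⁻¹ • Ω + ∑ α ∈ Δ', (α (q + t • v))⁻¹ • (e α ⊗ₜ[ℂ] e (-α))))
        (φ D) 0) :
    D = 0 ↔ ∀ α ∈ Δ', α v = 0 := by
  have hDeq : D = ∑ α ∈ Δ', (-(α v) / (α q) ^ 2) • (e α ⊗ₜ[ℂ] e (-α)) := by
    rw [← sub_eq_zero, ← Module.forall_dual_apply_eq_zero_iff ℂ]
    intro φ
    rw [map_sub, sub_eq_zero]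
    exact (hD φ).unique (hasDerivAt_apply_sum_inv_smul Δ' _ _ q v hq φ)
  rw [hDeq]
  constructor
  · intro h β hβ
    have hφ := congrArg (LinearMap.mul' ℂ ℂ ∘ₗ TensorProduct.map (B (e (-β))) (B (e β))) h
    simp only [map_sum, map_smul, map_zero, LinearMap.comp_apply, TensorProduct.map_tmul,
      LinearMap.mul'_apply, smul_eq_mul] at hφ
    rw [Finset.sum_eq_single_of_mem β hβ fun α hα hne => by
      simp [hee (-β) (hΔ'neg β hβ) α hα, hne]] at hφ
    simpa [hee (-β) (hΔ'neg β hβ) β hβ, hee β hβ (-β) (hΔ'neg β hβ), hq β hβ] using hφ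
  · intro h
    exact Finset.sum_eq_zero fun α hα => by simp [h α hα]
end
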